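/- (Dovbysh–Sudakov representation) The law of any Gram–de Finetti matrix is a mixture of laws generated by i.i.d. samples: there exist a probability space (Ω, F, Pr), a separable Hilbert space H, and a probability kernel assigning to each ω ∈ Ω a probability measure η_ω on H × [0,∞), such that for every Borel set A ⊆ M, P(R ∈ A) = ∫_Ω Q(ω, A) dPr(ω), where Q(ω,·) is the law of the infinite matrix (x_l · x_{l'} + a_l δ_{l,l'})_{l,l'≥1} in which (x_l, a_l)_{l≥1} is an i.i.d. sequence drawn from η_ω and δ_{l,l'} is the Kronecker delta. -/

import Mathlib

noncomputable section

/-- The space of infinite real matrices. -/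
abbrev Mat := ℕ → ℕ → ℝ

open MeasureTheory in
/-- `R` is a Gram–de Finetti matrix under `P`. -/
def IsGramDeFinetti {Ω : Type*} [MeasurableSpace Ω] (P : Measure Ω) (R : Ω → Mat) : Prop :=
  Measurable R ∧
  (∀ᵐ ω ∂P, ∀ i j, R ω i j ∈ Set.Icc (-1 : ℝ) 1) ∧
  (∀ᵐ ω ∂P, ∀ i j, R ω i j = R ω j i) ∧
  (∀ᵐ ω ∂P, ∀ (n : ℕ) (c : Fin n → ℝ),
    0 ≤ ∑ i : Fin n, ∑ j : Fin n, c i * c j * R ω i j) ∧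
  (∀ (n : ℕ) (ρ : Equiv.Perm (Fin n)),
    Measure.map (fun ω => fun i j : Fin n => R ω (ρ i) (ρ j)) P
      = Measure.map (fun ω => fun i j : Fin n => R ω i j) P)

/-- A separable Hilbert space: the space `ℓ²(ℕ, ℝ)`. -/
abbrev H2 : Type := lp (fun _ : ℕ => ℝ) 2

instance : MeasurableSpace H2 := borel _
instance : BorelSpace H2 := ⟨rfl⟩

open RealInnerProductSpace in
/-- The Gram matrix (plus diagonal perturbation `a_l δ_{l,l'}`) generated by a
sequence in `H2 × ℝ`. -/
def genMat (x : ℕ → H2 × ℝ) : Mat :=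
  fun i j => ⟪(x i).1, (x j).1⟫ + if i = j then (x i).2 else 0

/-- `ν` is the law of an i.i.d. sequence with marginal `η`: all finite-dimensional
cylinder probabilities are products. -/
def IsIIDFrom (ν : MeasureTheory.Measure (ℕ → H2 × ℝ))
    (η : MeasureTheory.Measure (H2 × ℝ)) : Prop :=
  ∀ (n : ℕ) (A : Fin n → Set (H2 × ℝ)), (∀ i, MeasurableSet (A i)) →
    ν {x | ∀ i : Fin n, x (i : ℕ) ∈ A i} = ∏ i : Fin n, η (A i)

/-- A Dovbysh–Sudakov representation of the law of `R`: a probability space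
`(Ω, Pr)` together with a Markov kernel `η` of probability measures on
`H × [0,∞)` (for the separable Hilbert space `H = ℓ²`) such that the law of `R`
is the mixture over `ω` of the laws of the matrices
`(x_l · x_{l'} + a_l δ_{l,l'})_{l,l'}` generated by i.i.d. samples
`(x_l, a_l)_{l ≥ 1}` from `η ω`. -/
structure DovbyshSudakovRep {Ω₁ : Type*} [MeasurableSpace Ω₁]
    (P : MeasureTheory.Measure Ω₁) (R : Ω₁ → Mat) where
  Ω : Type
  [mΩ : MeasurableSpace Ω]
  Pr : MeasureTheory.Measure Ω
  prob : MeasureTheory.IsProbabilityMeasure Pr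
  η : ProbabilityTheory.Kernel Ω (H2 × ℝ)
  markov : ProbabilityTheory.IsMarkovKernel η
  pos : ∀ ω, η ω {p | p.2 < 0} = 0
  ν : ProbabilityTheory.Kernel Ω (ℕ → H2 × ℝ)
  markov' : ProbabilityTheory.IsMarkovKernel ν
  iid : ∀ ω, IsIIDFrom (ν ω) (η ω)
  rep : ∀ A : Set Mat, MeasurableSet A →
    MeasureTheory.Measure.map R P A
      = MeasureTheory.lintegral Pr
          (fun ω => MeasureTheory.Measure.map genMat (ν ω) A)

section DeFinetti

open MeasureTheory ProbabilityTheory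

variable {E : Type*} [MeasurableSpace E]

/-- A measure on sequences is exchangeable if it is invariant under reindexing along injections. -/
def IsExchangeable (μ : Measure (ℕ → E)) : Prop :=
  ∀ τ : ℕ → ℕ, Function.Injective τ → μ.map (fun y i => y (τ i)) = μ

lemma IsExchangeable.lintegral_comp {μ : Measure (ℕ → E)} (hμ : IsExchangeable μ)
    {τ : ℕ → ℕ} (hτ : Function.Injective τ) {F : (ℕ → E) → ENNReal} (hF : Measurable F) :
    ∫⁻ y, F (fun i => y (τ i)) ∂μ = ∫⁻ y, F y ∂μ := by
  conv_rhs => rw [← hμ τ hτ]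
  rw [lintegral_map hF (by fun_prop)]

/-- The conditional law of one coordinate given infinitely many others. -/
def directing [StandardBorelSpace E] [Nonempty E] (μ : Measure (ℕ → E)) [IsProbabilityMeasure μ] :
    Kernel (ℕ → E) E :=
  (μ.map (fun y => ((fun i => y (i + 1)), y 0))).condKernel

instance [StandardBorelSpace E] [Nonempty E] (μ : Measure (ℕ → E)) [IsProbabilityMeasure μ] :
    IsMarkovKernel (directing μ) := by
  unfold directing; infer_instance

variable [StandardBorelSpace E] [Nonempty E] {μ : Measure (ℕ → E)} [IsProbabilityMeasure μ]

lemma lintegral_mul_directing (hμ : IsExchangeable μ) {s : ℕ → ℕ} (hs : Function.Injective s)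
    {a : ℕ} (ha : ∀ i, s i ≠ a) {A : Set E} (hA : MeasurableSet A)
    {h : (ℕ → E) → ENNReal} (hh : Measurable h) :
    ∫⁻ y, h (fun i => y (s i)) * A.indicator 1 (y a) ∂μ
      = ∫⁻ y, h (fun i => y (s i)) * directing μ (fun i => y (s i)) A ∂μ := by
  have hκ : Measurable fun y => directing μ y A := Kernel.measurable_coe _ hA
  have hτ : Function.Injective (fun i => Nat.casesOn (motive := fun _ => ℕ) i a s) := by
    rintro (_ | i) (_ | j) hij
    · rfl
    · exact absurd hij.symm (ha j)
    · exact absurd hij (ha i)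
    · exact congrArg _ (hs hij)
  have h1 : Measurable fun y : ℕ → E => h (fun i => y (i + 1)) * A.indicator 1 (y 0) := by
    have : Measurable (A.indicator (1 : E → ENNReal)) := measurable_one.indicator hA
    fun_prop
  have h2 : Measurable fun p : (ℕ → E) × E => h p.1 * A.indicator 1 p.2 := by
    have : Measurable (A.indicator (1 : E → ENNReal)) := measurable_one.indicator hA
    fun_prop
  have e1 := hμ.lintegral_comp hτ h1
  have e2 := hμ.lintegral_comp hs (hh.mul hκ)
  simp only [Pi.mul_apply] at e1 e2
  refine e1.trans (Eq.trans ?_ e2.symm)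
  have hm : Measurable fun y : ℕ → E => ((fun i => y (i + 1)), y 0) := by fun_prop
  have hfst : (μ.map (fun y : ℕ → E => ((fun i => y (i + 1)), y 0))).fst = μ := by
    rw [Measure.fst, Measure.map_map measurable_fst hm]
    exact hμ _ (add_left_injective 1)
  have e3 := Measure.lintegral_condKernel
    (ρ := μ.map (fun y : ℕ → E => ((fun i => y (i + 1)), y 0))) h2
  rw [lintegral_map h2 hm, hfst] at e3
  rw [← e3]
  refine lintegral_congr fun y => ?_
  have key := lintegral_const_mul (μ := directing μ y) (h y) (f := A.indicator 1)
    (measurable_one.indicator hA)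
  rw [lintegral_indicator_one hA] at key
  exact key

lemma directing_comp_ae_eq (hμ : IsExchangeable μ) {s u : ℕ → ℕ} (hs : Function.Injective s)
    (hu : Function.Injective u) {a : ℕ} (ha : ∀ i, s i ≠ a) {A : Set E} (hA : MeasurableSet A) :
    ∀ᵐ y ∂μ, directing μ (fun i => y (s i)) A = directing μ (fun i => y (s (u i))) A := by
  have hκ : Measurable fun y => directing μ y A := Kernel.measurable_coe _ hA
  set p : (ℕ → E) → ENNReal := fun y => directing μ (fun i => y (s i)) A with hp
  set q : (ℕ → E) → ENNReal := fun y => directing μ (fun i => y (s (u i))) A with hq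
  have hpm : Measurable p := hκ.comp (by fun_prop)
  have hqm : Measurable q := hκ.comp (by fun_prop)
  have hp1 : ∀ y, p y ≤ 1 := fun y => prob_le_one
  have hq1 : ∀ y, q y ≤ 1 := fun y => prob_le_one
  have hpp : ∫⁻ y, p y * p y ∂μ = ∫⁻ y, q y * q y ∂μ :=
    (hμ.lintegral_comp hs (hκ.mul hκ)).trans (hμ.lintegral_comp (hs.comp hu) (hκ.mul hκ)).symm
  have hqp : ∫⁻ y, q y * p y ∂μ = ∫⁻ y, q y * q y ∂μ :=
    (lintegral_mul_directing hμ hs ha hA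
      (h := fun z => directing μ (fun i => z (u i)) A) (hκ.comp (by fun_prop))).symm.trans
      (lintegral_mul_directing hμ (hs.comp hu) (fun i => ha (u i)) hA hκ)
  have toR : ∀ f g : (ℕ → E) → ENNReal, Measurable f → Measurable g → (∀ y, f y ≤ 1) →
      (∀ y, g y ≤ 1) → Integrable (fun y => (f y).toReal * (g y).toReal) μ ∧
        ∫ y, (f y).toReal * (g y).toReal ∂μ = (∫⁻ y, f y * g y ∂μ).toReal := by
    intro f g hf hg hf1 hg1
    have hle : ∀ y, f y * g y ≤ 1 := fun y => mul_le_one' (hf1 y) (hg1 y)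
    simp only [← ENNReal.toReal_mul]
    refine ⟨integrable_toReal_of_lintegral_ne_top (hf.mul hg).aemeasurable ?_,
      integral_toReal (hf.mul hg).aemeasurable
        (ae_of_all _ fun y => (hle y).trans_lt ENNReal.one_lt_top)⟩
    refine ne_top_of_le_ne_top ENNReal.one_ne_top ((lintegral_mono hle).trans ?_)
    simp
  obtain ⟨ipp, vpp⟩ := toR p p hpm hpm hp1 hp1
  obtain ⟨iqp, vqp⟩ := toR q p hqm hpm hq1 hp1
  obtain ⟨iqq, vqq⟩ := toR q q hqm hqm hq1 hq1
  have hsq : (fun y => ((p y).toReal - (q y).toReal) ^ 2) = fun y =>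
      (p y).toReal * (p y).toReal - 2 * ((q y).toReal * (p y).toReal)
        + (q y).toReal * (q y).toReal := by
    funext y; ring
  have hint : Integrable (fun y => ((p y).toReal - (q y).toReal) ^ 2) μ := by
    rw [hsq]; exact (ipp.sub (iqp.const_mul 2)).add iqq
  have h0 : ∫ y, ((p y).toReal - (q y).toReal) ^ 2 ∂μ = 0 := by
    have ipq : Integrable (fun y => (p y).toReal * (p y).toReal
        - 2 * ((q y).toReal * (p y).toReal)) μ := ipp.sub (iqp.const_mul 2)
    rw [hsq, integral_add ipq iqq, integral_sub ipp (iqp.const_mul 2),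
      integral_const_mul, vpp, vqp, vqq, hpp, hqp]
    ring
  rw [integral_eq_zero_iff_of_nonneg (fun y => sq_nonneg _) hint] at h0
  filter_upwards [h0] with y hy
  have h3 : (p y).toReal = (q y).toReal := by
    have : ((p y).toReal - (q y).toReal) ^ 2 = 0 := hy
    nlinarith [pow_eq_zero_iff (two_ne_zero) |>.1 this]
  exact (ENNReal.toReal_eq_toReal_iff' (ne_top_of_le_ne_top ENNReal.one_ne_top (hp1 y))
    (ne_top_of_le_ne_top ENNReal.one_ne_top (hq1 y))).1 h3

lemma lintegral_mul_prod_indicator (hμ : IsExchangeable μ) {A : ℕ → Set E}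
    (hA : ∀ i, MeasurableSet (A i)) (n : ℕ) {g : (ℕ → E) → ENNReal} (hg : Measurable g) :
    ∫⁻ y, g (fun k => y (2 * k + 1)) * ∏ i ∈ Finset.range n, (A i).indicator 1 (y (2 * i)) ∂μ
      = ∫⁻ y, g y * ∏ i ∈ Finset.range n, directing μ y (A i) ∂μ := by
  have hodd : Function.Injective fun k : ℕ => 2 * k + 1 := fun a b h => by simpa using h
  induction n generalizing g with
  | zero =>
    simpa using hμ.lintegral_comp hodd hg
  | succ n ih =>
    have hκ : Measurable fun y => directing μ y (A n) := Kernel.measurable_coe _ (hA n)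
    have hi : ∀ i, Measurable ((A i).indicator (1 : E → ENNReal)) :=
      fun i => measurable_one.indicator (hA i)
    let s : ℕ → ℕ := fun k => if k < 2 * n then k else k + 1
    let u : ℕ → ℕ := fun k => if 2 * k + 1 < 2 * n then 2 * k + 1 else 2 * k
    have hs : Function.Injective s := by
      intro a b h; simp only [s] at h; split_ifs at h <;> omega
    have hu : Function.Injective u := by
      intro a b h; simp only [u] at h; split_ifs at h <;> omega
    have ha : ∀ k, s k ≠ 2 * n := by
      intro k; simp only [s]; split_ifs <;> omega
    have hsu : ∀ k, s (u k) = 2 * k + 1 := by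
      intro k; simp only [s, u]; split_ifs <;> omega
    have hse : ∀ i ∈ Finset.range n, s (2 * i) = 2 * i := by
      intro i hi; have := Finset.mem_range.1 hi; simp only [s]; split_ifs <;> omega
    let h : (ℕ → E) → ENNReal := fun z =>
      g (fun k => z (u k)) * ∏ i ∈ Finset.range n, (A i).indicator 1 (z (2 * i))
    have hh : Measurable h := by
      refine (hg.comp (by fun_prop)).mul (Finset.measurable_fun_prod _ fun i _ => ?_)
      exact (hi i).comp (measurable_pi_apply _)
    have hhs : ∀ y : ℕ → E, h (fun i => y (s i)) = g (fun k => y (2 * k + 1)) *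
        ∏ i ∈ Finset.range n, (A i).indicator 1 (y (2 * i)) := by
      intro y
      simp only [h, hsu]
      congr 1
      exact Finset.prod_congr rfl fun i hi => by rw [hse i hi]
    have e1 := lintegral_mul_directing hμ hs ha (hA n) hh
    simp only [hhs] at e1
    have e2 := ih (g := fun y => g y * directing μ y (A n)) (hg.mul hκ)
    have e3 := directing_comp_ae_eq hμ hs hu ha (hA n)
    simp only [hsu] at e3
    simp only [Finset.prod_range_succ, ← mul_assoc]
    rw [e1]
    calc _ = ∫⁻ y, g (fun k => y (2 * k + 1)) * directing μ (fun k => y (2 * k + 1)) (A n) *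
          ∏ i ∈ Finset.range n, (A i).indicator 1 (y (2 * i)) ∂μ := by
            refine lintegral_congr_ae ?_
            filter_upwards [e3] with y hy
            rw [hy]; ring
      _ = _ := e2
      _ = _ := lintegral_congr fun y => by ring

/-- **de Finetti's theorem**: cylinder probabilities of an exchangeable sequence are mixtures of
products. -/
theorem IsExchangeable.measure_cylinder (hμ : IsExchangeable μ) {A : ℕ → Set E}
    (hA : ∀ i, MeasurableSet (A i)) (n : ℕ) :
    μ {y | ∀ i < n, y i ∈ A i} = ∫⁻ y, ∏ i ∈ Finset.range n, directing μ y (A i) ∂μ := by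
  have heven : Function.Injective fun k : ℕ => 2 * k := fun a b h => by simpa using h
  have h1 := lintegral_mul_prod_indicator hμ hA n (g := fun _ => 1) measurable_const
  simp only [one_mul] at h1
  have hi : ∀ i, Measurable ((A i).indicator (1 : E → ENNReal)) :=
    fun i => measurable_one.indicator (hA i)
  have hm : Measurable fun y : ℕ → E => ∏ i ∈ Finset.range n,
      (A i).indicator (1 : E → ENNReal) (y i) :=
    Finset.measurable_fun_prod _ fun i _ => (hi i).comp (measurable_pi_apply _)
  have hS : MeasurableSet {y : ℕ → E | ∀ i < n, y i ∈ A i} := by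
    have : {y : ℕ → E | ∀ i < n, y i ∈ A i} = (Finset.range n : Set ℕ).pi A := by
      ext y; simp [Set.mem_pi]
    rw [this]
    exact MeasurableSet.pi (Finset.countable_toSet _) fun i _ => hA i
  rw [← h1, hμ.lintegral_comp heven hm, ← lintegral_indicator_one hS]
  refine lintegral_congr fun y => ?_
  by_cases hy : ∀ i < n, y i ∈ A i
  · rw [Set.indicator_of_mem (by exact hy), Finset.prod_eq_one]
    · rfl
    · intro i hi
      rw [Set.indicator_of_mem (hy i (Finset.mem_range.1 hi))]
      rfl
  · rw [Set.indicator_of_notMem (by exact hy)]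
    push Not at hy
    obtain ⟨i, hin, hi⟩ := hy
    rw [Finset.prod_eq_zero (Finset.mem_range.2 hin) (Set.indicator_of_notMem hi _)]

end DeFinetti

section Mixture

open MeasureTheory ProbabilityTheory

variable {Ω E : Type*} [MeasurableSpace Ω] [MeasurableSpace E]

lemma exists_eq_pi_range_of_mem_squareCylinders {S : Set (ℕ → E)}
    (hS : S ∈ squareCylinders fun _ : ℕ => {s : Set E | MeasurableSet s}) :
    ∃ (n : ℕ) (A : ℕ → Set E), (∀ i, MeasurableSet (A i)) ∧
      S = (Finset.range n : Set ℕ).pi A := by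
  classical
  obtain ⟨s, t, ht, rfl⟩ := hS
  obtain ⟨n, hn⟩ := s.exists_nat_subset_range
  refine ⟨n, fun i => if i ∈ s then t i else Set.univ, fun i => ?_, ?_⟩
  · dsimp only
    split_ifs
    · exact ht i (Set.mem_univ i)
    · exact MeasurableSet.univ
  · ext y
    simp only [Set.mem_pi, Finset.mem_coe]
    constructor
    · intro h i _
      split_ifs with hi
      · exact h i hi
      · trivial
    · intro h i hi
      simpa [hi] using h i (hn hi)

lemma isPiSystem_measurable_squareCylinders :
    IsPiSystem (squareCylinders fun _ : ℕ => {s : Set E | MeasurableSet s}) :=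
  isPiSystem_squareCylinders (fun _ => MeasurableSpace.isPiSystem_measurableSet)
    fun _ => MeasurableSet.univ

/-- The kernel of laws of i.i.d. sequences with marginals given by a Markov kernel. -/
def iidKernel (η : Kernel Ω E) [IsMarkovKernel η] : Kernel Ω (ℕ → E) where
  toFun ω := Measure.infinitePi fun _ => η ω
  measurable' := by
    refine Measurable.measure_of_isPiSystem_of_isProbabilityMeasure
      generateFrom_squareCylinders.symm isPiSystem_measurable_squareCylinders fun S hS => ?_
    obtain ⟨n, A, hA, rfl⟩ := exists_eq_pi_range_of_mem_squareCylinders hS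
    simp only [Measure.infinitePi_pi _ fun i _ => hA i]
    exact Finset.measurable_fun_prod _ fun i _ => Kernel.measurable_coe _ (hA i)

lemma iidKernel_pi (η : Kernel Ω E) [IsMarkovKernel η] (ω : Ω) {A : ℕ → Set E}
    (hA : ∀ i, MeasurableSet (A i)) (n : ℕ) :
    iidKernel η ω ((Finset.range n : Set ℕ).pi A) = ∏ i ∈ Finset.range n, η ω (A i) :=
  Measure.infinitePi_pi _ fun i _ => hA i

instance (η : Kernel Ω E) [IsMarkovKernel η] : IsMarkovKernel (iidKernel η) :=
  ⟨fun ω => inferInstanceAs (IsProbabilityMeasure (Measure.infinitePi fun _ => η ω))⟩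

lemma eq_bind_iidKernel {μ : Measure (ℕ → E)} [IsProbabilityMeasure μ] {P : Measure Ω}
    [IsProbabilityMeasure P] (η : Kernel Ω E) [IsMarkovKernel η]
    (h : ∀ (n : ℕ) (A : ℕ → Set E), (∀ i, MeasurableSet (A i)) →
      μ ((Finset.range n : Set ℕ).pi A) = ∫⁻ ω, ∏ i ∈ Finset.range n, η ω (A i) ∂P) :
    μ = P.bind (iidKernel η) := by
  refine ext_of_generate_finite _ generateFrom_squareCylinders.symm
    isPiSystem_measurable_squareCylinders (fun S hS => ?_) (by simp)
  obtain ⟨n, A, hA, rfl⟩ := exists_eq_pi_range_of_mem_squareCylinders hS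
  rw [h n A hA, Measure.bind_apply (MeasurableSet.pi (Finset.countable_toSet _) fun i _ => hA i)
    (Kernel.aemeasurable _)]
  exact lintegral_congr fun ω => (iidKernel_pi η ω hA n).symm

end Mixture

section Schur

/-- Nonnegative definiteness of an infinite matrix, tested on finitely supported vectors. -/
def IsNonnegDef (M : Mat) : Prop :=
  ∀ (n : ℕ) (c : ℕ → ℝ),
    0 ≤ ∑ i ∈ Finset.range n, ∑ j ∈ Finset.range n, c i * c j * M i j

/-- The Schur complement of `M` with respect to the index `b` (equal to `M` if `M b b = 0`). -/
def schur (M : Mat) (b : ℕ) : Mat := fun i j => M i j - M i b * M j b / M b b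

/-- Iterated Schur complements along a sequence of indices. -/
def resid (b : ℕ → ℕ) (M : Mat) : ℕ → Mat
  | 0 => M
  | n + 1 => schur (resid b M n) (b n)

lemma sum_range_extend {N n : ℕ} (h : n ≤ N) (f : ℕ → ℝ) :
    ∑ i ∈ Finset.range N, (if i < n then f i else 0) = ∑ i ∈ Finset.range n, f i := by
  rw [← Finset.sum_filter]
  congr 1
  ext i
  simp only [Finset.mem_filter, Finset.mem_range]
  omega

lemma IsNonnegDef.schur {M : Mat} (hM : IsNonnegDef M) (hs : ∀ i j, M i j = M j i) (b : ℕ) :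
    IsNonnegDef (schur M b) := by
  intro n c
  obtain ⟨N, hnN, hbN⟩ : ∃ N, n ≤ N ∧ b < N := ⟨max n (b + 1), by simp, by simp⟩
  set d : ℕ → ℝ := fun i => if i < n then c i else 0 with hd
  set L : ℝ := ∑ i ∈ Finset.range N, d i * M i b with hL
  have hext : ∀ W : Mat, ∑ i ∈ Finset.range n, ∑ j ∈ Finset.range n, c i * c j * W i j
      = ∑ i ∈ Finset.range N, ∑ j ∈ Finset.range N, d i * d j * W i j := by
    intro W
    rw [← sum_range_extend hnN]
    refine Finset.sum_congr rfl fun i _ => ?_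
    by_cases hi : i < n
    · rw [if_pos hi, ← sum_range_extend hnN]
      refine Finset.sum_congr rfl fun j _ => ?_
      by_cases hj : j < n <;> simp [hd, hi, hj]
    · simp [hd, hi]
  rw [hext]
  have hq : ∑ i ∈ Finset.range N, ∑ j ∈ Finset.range N, d i * d j * _root_.schur M b i j
      = ∑ i ∈ Finset.range N, ∑ j ∈ Finset.range N, d i * d j * M i j - L * L / M b b := by
    rw [hL, Finset.sum_mul_sum, Finset.sum_div, ← Finset.sum_sub_distrib]
    refine Finset.sum_congr rfl fun i _ => ?_
    rw [Finset.sum_div, ← Finset.sum_sub_distrib]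
    refine Finset.sum_congr rfl fun j _ => ?_
    unfold _root_.schur
    ring
  rw [hq]
  by_cases hb : M b b = 0
  · simpa [hb] using hM N d
  set t : ℝ := - L / M b b with ht
  have h := hM N (fun i => d i + if i = b then t else 0)
  have hx : ∑ i ∈ Finset.range N, ∑ j ∈ Finset.range N,
      (d i + if i = b then t else 0) * (d j + if j = b then t else 0) * M i j
      = ∑ i ∈ Finset.range N, ∑ j ∈ Finset.range N, d i * d j * M i j + 2 * t * L
        + t * t * M b b := by
    have hin : ∀ i, ∑ j ∈ Finset.range N,
        (d i + if i = b then t else 0) * (d j + if j = b then t else 0) * M i j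
        = ∑ j ∈ Finset.range N, d i * d j * M i j + t * (d i * M i b)
          + (if i = b then t * (∑ j ∈ Finset.range N, d j * M j b) + t * t * M b b else 0) := by
      intro i
      have : ∀ j, (d i + if i = b then t else 0) * (d j + if j = b then t else 0) * M i j
          = d i * d j * M i j + (if j = b then t * (d i * M i b) else 0)
            + ((if i = b then t * (d j * M j b) else 0)
            + (if j = b then if i = b then t * t * M b b else 0 else 0)) := by
        intro j
        by_cases hi : i = b <;> by_cases hj : j = b
        · subst hi; subst hj; simp; ring
        · subst hi; simp [hj, hs i j]; ring
        · subst hj; simp [hi]; ring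
        · simp [hi, hj]
      simp only [this, Finset.sum_add_distrib, Finset.sum_ite_eq', Finset.mem_range, hbN, if_true]
      by_cases hi : i = b <;> simp [hi, Finset.mul_sum]
    simp only [hin, Finset.sum_add_distrib, Finset.sum_ite_eq', Finset.mem_range, hbN, if_true,
      ← Finset.mul_sum]
    ring
  rw [hx] at h
  have : 2 * t * L + t * t * M b b = - (L * L / M b b) := by
    rw [ht]; field_simp; ring
  linarith

lemma resid_symm {b : ℕ → ℕ} {M : Mat} (hs : ∀ i j, M i j = M j i) (n i j : ℕ) :
    resid b M n i j = resid b M n j i := by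
  induction n with
  | zero => exact hs i j
  | succ n ih => simp only [resid, schur, ih, mul_comm (resid b M n i (b n))]

lemma IsNonnegDef.resid {b : ℕ → ℕ} {M : Mat} (hM : IsNonnegDef M)
    (hs : ∀ i j, M i j = M j i) (n : ℕ) : IsNonnegDef (resid b M n) := by
  induction n with
  | zero => exact hM
  | succ n ih => exact ih.schur (fun i j => resid_symm hs n i j) (b n)

lemma IsNonnegDef.diag_nonneg {M : Mat} (hM : IsNonnegDef M) (i : ℕ) : 0 ≤ M i i := by
  have h := hM (i + 1) (fun j => if j = i then 1 else 0)
  simpa [Finset.sum_ite_eq', ite_mul] using h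

lemma IsNonnegDef.sq_le {M : Mat} (hM : IsNonnegDef M) (hs : ∀ i j, M i j = M j i)
    {i j : ℕ} (hj : M j j ≤ 1) : M i j ^ 2 ≤ M i j * M i j / M j j := by
  have h0 := hM.diag_nonneg j
  rcases h0.eq_or_lt with h | h
  · have key : ∀ t : ℝ, 0 ≤ M i i + 2 * t * M i j := by
      intro t
      by_cases hij : i = j
      · subst hij; simp [← h]
      obtain ⟨N, h1, h2⟩ : ∃ N, i < N ∧ j < N := ⟨max i j + 1, by grind, by grind⟩
      have := hM N (fun k => (if k = i then 1 else 0) + if k = j then t else 0)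
      simp only [add_mul, mul_add, Finset.sum_add_distrib, ite_mul, mul_ite, one_mul, mul_one,
        zero_mul, mul_zero, Finset.sum_ite_eq', Finset.mem_range, h1, h2, if_true, ← h] at this
      simp [hs j i] at this
      linarith
    have hz : M i j = 0 := by
      by_contra hne
      have := key (-(M i i + 1) / (2 * M i j))
      have h2 : 2 * (-(M i i + 1) / (2 * M i j)) * M i j = -(M i i + 1) := by field_simp
      linarith
    simp [hz]
  · rw [le_div_iff₀ h]
    nlinarith [sq_nonneg (M i j)]

lemma resid_succ_diag_le {b : ℕ → ℕ} {M : Mat} (hM : IsNonnegDef M)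
    (hs : ∀ i j, M i j = M j i) (n i : ℕ) : resid b M (n + 1) i i ≤ resid b M n i i := by
  have := (hM.resid (b := b) hs n).diag_nonneg (b n)
  simp only [resid, schur]
  have := div_nonneg (mul_self_nonneg (resid b M n i (b n))) this
  linarith

lemma resid_diag_le {b : ℕ → ℕ} {M : Mat} (hM : IsNonnegDef M)
    (hs : ∀ i j, M i j = M j i) (n i : ℕ) : resid b M n i i ≤ M i i := by
  induction n with
  | zero => exact le_rfl
  | succ n ih => exact (resid_succ_diag_le hM hs n i).trans ih

lemma resid_reindex (b σ : ℕ → ℕ) (M : Mat) (n i j : ℕ) :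
    resid b (fun i j => M (σ i) (σ j)) n i j = resid (fun k => σ (b k)) M n (σ i) (σ j) := by
  induction n generalizing i j with
  | zero => rfl
  | succ n ih => simp only [resid, schur, ih]

lemma resid_congr {b b' : ℕ → ℕ} (M : Mat) {n : ℕ} (h : ∀ k < n, b k = b' k) :
    resid b M n = resid b' M n := by
  induction n with
  | zero => rfl
  | succ n ih =>
    simp only [resid, ih fun k hk => h k (by omega), h n (by omega)]

/-- The coordinates of the projection of the `i`-th vector on the Gram–Schmidt basis
obtained from the vectors indexed by `b`. -/
def coef (b : ℕ → ℕ) (M : Mat) (i k : ℕ) : ℝ :=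
  resid b M k i (b k) / √(resid b M k (b k) (b k))

lemma sum_coef_mul_coef {b : ℕ → ℕ} {M : Mat} (hM : IsNonnegDef M)
    (hs : ∀ i j, M i j = M j i) (n i j : ℕ) :
    ∑ k ∈ Finset.range n, coef b M i k * coef b M j k = M i j - resid b M n i j := by
  induction n with
  | zero => simp [resid]
  | succ n ih =>
    have h := (hM.resid (b := b) hs n).diag_nonneg (b n)
    rw [Finset.sum_range_succ, ih, coef, coef, div_mul_div_comm, Real.mul_self_sqrt h]
    simp only [resid, schur]
    ring

lemma measurable_schur {α : Type*} [MeasurableSpace α] {f : α → Mat} (hf : Measurable f) (b : ℕ) :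
    Measurable fun x => schur (f x) b := by
  unfold schur
  fun_prop

lemma measurable_resid (b : ℕ → ℕ) (n : ℕ) : Measurable fun M => resid b M n := by
  induction n with
  | zero => exact measurable_id
  | succ n ih => exact measurable_schur ih (b n)

lemma measurable_coef (b : ℕ → ℕ) (i k : ℕ) : Measurable fun M => coef b M i k := by
  have := measurable_resid b k
  unfold coef
  fun_prop

end Schur

section Hilbert

open MeasureTheory Filter Topology

instance : SecondCountableTopology H2 := by
  let S : Submodule ℝ H2 :=
    Submodule.span ℝ (Set.range fun k : ℕ => lp.single (E := fun _ : ℕ => ℝ) 2 k 1)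
  have hs : TopologicalSpace.IsSeparable (S : Set H2) :=
    (Set.countable_range _).isSeparable.span
  have hd : Dense (S : Set H2) := by
    intro f
    refine mem_closure_of_tendsto (lp.hasSum_single (by simp) f) (Eventually.of_forall fun s => ?_)
    refine Submodule.sum_mem _ fun i _ => ?_
    have : lp.single (E := fun _ : ℕ => ℝ) 2 i (f i)
        = (f i : ℝ) • lp.single (E := fun _ : ℕ => ℝ) 2 i 1 := by
      rw [← lp.single_smul]; simp
    rw [this]
    exact Submodule.smul_mem _ _ (Submodule.subset_span ⟨i, rfl⟩)
  have : TopologicalSpace.SeparableSpace H2 := by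
    rw [← TopologicalSpace.isSeparable_univ_iff, ← hd.closure_eq]
    exact hs.closure
  exact UniformSpace.secondCountable_of_separable H2

lemma memℓp_of_sum_le {f : ℕ → ℝ} (h : ∀ n, ∑ k ∈ Finset.range n, f k * f k ≤ 1) :
    Memℓp f 2 := by
  refine memℓp_gen (summable_of_sum_range_le (c := 1) (fun k => by positivity) fun n => ?_)
  refine le_trans (le_of_eq (Finset.sum_congr rfl fun k _ => ?_)) (h n)
  simp [sq]

open Classical in
/-- The vector of `ℓ²` with given coordinates, or `0` if these do not lie in the unit ball. -/
def toH2 (f : ℕ → ℝ) : H2 :=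
  if h : ∀ n, ∑ k ∈ Finset.range n, f k * f k ≤ 1 then ⟨f, memℓp_of_sum_le h⟩ else 0

lemma toH2_apply {f : ℕ → ℝ} (h : ∀ n, ∑ k ∈ Finset.range n, f k * f k ≤ 1) (k : ℕ) :
    toH2 f k = f k := by
  rw [toH2, dif_pos h]

lemma tendsto_sum_toH2 {f g : ℕ → ℝ} (hf : ∀ n, ∑ k ∈ Finset.range n, f k * f k ≤ 1)
    (hg : ∀ n, ∑ k ∈ Finset.range n, g k * g k ≤ 1) :
    Tendsto (fun n => ∑ k ∈ Finset.range n, f k * g k) atTop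
      (𝓝 (inner ℝ (toH2 f) (toH2 g))) := by
  have := (lp.hasSum_inner (𝕜 := ℝ) (toH2 f) (toH2 g)).tendsto_sum_nat
  simpa [toH2_apply hf, toH2_apply hg, mul_comm] using this

lemma measurable_toH2 : Measurable toH2 := by
  classical
  let S : Set (ℕ → ℝ) := {f | ∀ n, ∑ k ∈ Finset.range n, f k * f k ≤ 1}
  have hS : MeasurableSet S := by
    simp only [S, Set.ofPred_forall]
    exact MeasurableSet.iInter fun n => measurableSet_le
      (Finset.measurable_fun_sum _ fun k _ => by fun_prop) measurable_const
  let u : ℕ → (ℕ → ℝ) → H2 := fun n f =>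
    ∑ k ∈ Finset.range n, f k • lp.single (E := fun _ : ℕ => ℝ) 2 k 1
  have hu : ∀ n, Measurable (u n) := fun n =>
    Finset.measurable_fun_sum _ fun k _ => by fun_prop
  refine measurable_of_tendsto_metrizable
    (f := fun n => S.piecewise (u n) fun _ => 0)
    (fun n => (hu n).piecewise hS measurable_const) (tendsto_pi_nhds.2 fun f => ?_)
  by_cases h : f ∈ S
  · simp only [Set.piecewise_eq_of_mem _ _ _ h]
    have := (lp.hasSum_single (p := 2) (by simp) (toH2 f)).tendsto_sum_nat
    refine this.congr fun n => Finset.sum_congr rfl fun k _ => ?_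
    rw [toH2_apply h, ← lp.single_smul]
    simp
  · simp only [Set.piecewise_eq_of_notMem _ _ _ h]
    have : toH2 f = 0 := dif_neg h
    rw [this]
    exact tendsto_const_nhds

end Hilbert

section Gram

open MeasureTheory ProbabilityTheory Filter Topology

/-- Symmetric nonnegative definite matrices with diagonal at most `1`. -/
structure IsGram (M : Mat) : Prop where
  symm : ∀ i j, M i j = M j i
  nonneg : IsNonnegDef M
  diag_le : ∀ i, M i i ≤ 1

lemma measurableSet_isGram : MeasurableSet {M : Mat | IsGram M} := by
  have : {M : Mat | IsGram M} = {M | ∀ i j, M i j = M j i} ∩ {M | IsNonnegDef M}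
      ∩ {M | ∀ i, M i i ≤ 1} := by
    ext M
    exact ⟨fun h => ⟨⟨h.1, h.2⟩, h.3⟩, fun h => ⟨h.1.1, h.1.2, h.2⟩⟩
  rw [this]
  refine IsClosed.measurableSet (IsClosed.inter (IsClosed.inter ?_ ?_) ?_)
  · simp only [Set.ofPred_forall]
    exact isClosed_iInter fun i => isClosed_iInter fun j =>
      isClosed_eq (by fun_prop) (by fun_prop)
  · simp only [IsNonnegDef, Set.ofPred_forall]
    exact isClosed_iInter fun n => isClosed_iInter fun c =>
      isClosed_le continuous_const (by fun_prop)
  · simp only [Set.ofPred_forall]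
    exact isClosed_iInter fun i => isClosed_le (by fun_prop) continuous_const

variable {μ : Measure Mat}

lemma integrable_resid [IsProbabilityMeasure μ] (hG : ∀ᵐ M ∂μ, IsGram M) (b : ℕ → ℕ) (n i : ℕ) :
    Integrable (fun M => resid b M n i i) μ := by
  have hm : Measurable fun M => resid b M n i i := by
    have := measurable_resid b n
    fun_prop
  refine Integrable.of_bound hm.aestronglyMeasurable 1 ?_
  filter_upwards [hG] with M hM
  rw [Real.norm_of_nonneg ((hM.nonneg.resid hM.symm n).diag_nonneg i)]
  exact (resid_diag_le hM.nonneg hM.symm n i).trans (hM.diag_le i)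

lemma lintegral_resid_sq_le [IsProbabilityMeasure μ] (hG : ∀ᵐ M ∂μ, IsGram M)
    (hμ : ∀ σ : ℕ → ℕ, Function.Injective σ → μ.map (fun M i j => M (σ i) (σ j)) = μ)
    {b : ℕ → ℕ} (hb : Function.Injective b) {i j : ℕ} (hij : i ≠ j) (hi : ∀ k, b k ≠ i)
    (hj : ∀ k, b k ≠ j) (n : ℕ) :
    ∫⁻ M, ENNReal.ofReal (resid b M n i j ^ 2) ∂μ
      ≤ ENNReal.ofReal (∫ M, resid b M n i i ∂μ - ∫ M, resid b M (n + 1) i i ∂μ) := by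
  let σ := Equiv.swap (b n) j
  have hσ : MeasurePreserving (fun (M : Mat) i j => M (σ i) (σ j)) μ μ :=
    ⟨by fun_prop, hμ σ σ.injective⟩
  have hstep : ∀ M : Mat, resid b (fun i j => M (σ i) (σ j)) (n + 1) i i
      = resid b M n i i - resid b M n i j * resid b M n i j / resid b M n j j := by
    intro M
    have hσi : σ i = i := Equiv.swap_apply_of_ne_of_ne (hi n).symm hij
    have hσn : σ (b n) = j := Equiv.swap_apply_left _ _
    rw [resid_reindex, hσi]
    simp only [resid, schur, hσn]
    rw [resid_congr (b' := b) M fun k hk =>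
      Equiv.swap_apply_of_ne_of_ne (fun h => hk.ne (hb h)) (hj k)]
  have hint := integrable_resid hG b n i
  have hint' : Integrable (fun M : Mat => resid b (fun i j => M (σ i) (σ j)) (n + 1) i i) μ :=
    hσ.integrable_comp_of_integrable (integrable_resid hG b (n + 1) i)
  have hval : ∫ M, resid b M (n + 1) i i ∂μ
      = ∫ M : Mat, resid b (fun i j => M (σ i) (σ j)) (n + 1) i i ∂μ := by
    conv_lhs => rw [← hσ.map_eq]
    refine integral_map hσ.measurable.aemeasurable ?_
    rw [hσ.map_eq]
    exact (integrable_resid hG b (n + 1) i).aestronglyMeasurable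
  have hsub : Integrable (fun M : Mat => resid b M n i i
      - resid b (fun i j => M (σ i) (σ j)) (n + 1) i i) μ := hint.sub hint'
  rw [hval, ← integral_sub hint hint', ofReal_integral_eq_lintegral_ofReal hsub]
  · refine lintegral_mono_ae ?_
    filter_upwards [hG] with M hM
    refine ENNReal.ofReal_le_ofReal ?_
    rw [hstep, sub_sub_cancel]
    exact (hM.nonneg.resid hM.symm n).sq_le (fun i j => resid_symm hM.symm n i j)
      ((resid_diag_le hM.nonneg hM.symm n j).trans (hM.diag_le j))
  · filter_upwards [hG] with M hM
    simp only [Pi.zero_apply, hstep, sub_sub_cancel]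
    exact div_nonneg (mul_self_nonneg _) ((hM.nonneg.resid hM.symm n).diag_nonneg j)

/-- The components of two vectors orthogonal to infinitely many others are a.s. orthogonal to
each other. -/
lemma tendsto_resid_zero [IsProbabilityMeasure μ] (hG : ∀ᵐ M ∂μ, IsGram M)
    (hμ : ∀ σ : ℕ → ℕ, Function.Injective σ → μ.map (fun M i j => M (σ i) (σ j)) = μ)
    {b : ℕ → ℕ} (hb : Function.Injective b) {i j : ℕ} (hij : i ≠ j) (hi : ∀ k, b k ≠ i)
    (hj : ∀ k, b k ≠ j) : ∀ᵐ M ∂μ, Tendsto (fun n => resid b M n i j) atTop (𝓝 0) := by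
  have hm : ∀ n, Measurable fun M => ENNReal.ofReal (resid b M n i j ^ 2) := fun n => by
    have := measurable_resid b n
    fun_prop
  have hmono : ∀ n, 0 ≤ ∫ M, resid b M n i i ∂μ - ∫ M, resid b M (n + 1) i i ∂μ := fun n => by
    refine sub_nonneg.2 (integral_mono_ae (integrable_resid hG b (n + 1) i)
      (integrable_resid hG b n i) ?_)
    filter_upwards [hG] with M hM using resid_succ_diag_le hM.nonneg hM.symm n i
  have hsum : ∫⁻ M, ∑' n, ENNReal.ofReal (resid b M n i j ^ 2) ∂μ
      ≤ ENNReal.ofReal (∫ M, resid b M 0 i i ∂μ) := by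
    rw [lintegral_tsum fun n => (hm n).aemeasurable]
    refine ENNReal.tsum_le_of_sum_range_le fun N => ?_
    refine (Finset.sum_le_sum fun n _ => lintegral_resid_sq_le hG hμ hb hij hi hj n).trans ?_
    rw [← ENNReal.ofReal_sum_of_nonneg fun n _ => hmono n, Finset.sum_range_sub']
    refine ENNReal.ofReal_le_ofReal (sub_le_self _ (integral_nonneg_of_ae ?_))
    filter_upwards [hG] with M hM using (hM.nonneg.resid hM.symm N).diag_nonneg i
  have hae := ae_lt_top (Measurable.tsum hm) (hsum.trans_lt ENNReal.ofReal_lt_top).ne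
  filter_upwards [hae] with M hM
  have h1 := (ENNReal.tendsto_toReal ENNReal.zero_ne_top).comp
    (ENNReal.tendsto_atTop_zero_of_tsum_ne_top hM.ne)
  have h2 : Tendsto (fun n => resid b M n i j ^ 2) atTop (𝓝 0) := by
    refine (h1.congr fun n => ?_)
    exact ENNReal.toReal_ofReal (sq_nonneg _)
  have h3 := (Real.continuous_sqrt.tendsto 0).comp h2
  rw [Real.sqrt_zero] at h3
  refine squeeze_zero_norm (fun n => ?_) h3
  simp [Real.sqrt_sq_eq_abs]

lemma IsGram.sum_coef_sq_le {M : Mat} (hM : IsGram M) (b : ℕ → ℕ) (i n : ℕ) :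
    ∑ k ∈ Finset.range n, coef b M i k * coef b M i k ≤ M i i := by
  rw [sum_coef_mul_coef hM.nonneg hM.symm]
  exact sub_le_self _ ((hM.nonneg.resid hM.symm n).diag_nonneg i)

/-- The point of `H2 × ℝ` attached to the index `2 * i`: the projection of the corresponding vector
on the span of the vectors with odd indices, and the squared norm of the orthogonal component. -/
def gramPoint (M : Mat) (i : ℕ) : H2 × ℝ :=
  (toH2 (coef (fun k => 2 * k + 1) M (2 * i)),
    max (M (2 * i) (2 * i) - inner ℝ (toH2 (coef (fun k => 2 * k + 1) M (2 * i)))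
      (toH2 (coef (fun k => 2 * k + 1) M (2 * i)))) 0)

lemma measurable_gramPoint : Measurable gramPoint := by
  refine measurable_pi_iff.2 fun i => ?_
  have h : Measurable fun M => toH2 (coef (fun k => 2 * k + 1) M (2 * i)) :=
    measurable_toH2.comp (measurable_pi_iff.2 fun k => measurable_coef _ _ k)
  unfold gramPoint
  fun_prop

lemma measurable_genMat : Measurable genMat := by
  refine measurable_pi_iff.2 fun i => measurable_pi_iff.2 fun j => ?_
  unfold genMat
  split_ifs <;> fun_prop

lemma genMat_gramPoint [IsProbabilityMeasure μ] (hG : ∀ᵐ M ∂μ, IsGram M)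
    (hμ : ∀ σ : ℕ → ℕ, Function.Injective σ → μ.map (fun M i j => M (σ i) (σ j)) = μ) :
    ∀ᵐ M ∂μ, genMat (gramPoint M) = fun i j => M (2 * i) (2 * j) := by
  have hodd : Function.Injective fun k : ℕ => 2 * k + 1 := fun a b h => by simpa using h
  have h : ∀ᵐ M ∂μ, ∀ i j : ℕ, i ≠ j →
      Tendsto (fun n => resid (fun k => 2 * k + 1) M n (2 * i) (2 * j)) atTop (𝓝 0) := by
    refine ae_all_iff.2 fun i => ae_all_iff.2 fun j => ?_
    by_cases hij : i = j
    · simp [hij]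
    · filter_upwards [tendsto_resid_zero hG hμ hodd (i := 2 * i) (j := 2 * j) (by omega)
        (fun k => by omega) (fun k => by omega)] with M hM _ using hM
  filter_upwards [hG, h] with M hM hlim
  have hle : ∀ i n, ∑ k ∈ Finset.range n, coef (fun k => 2 * k + 1) M i k
      * coef (fun k => 2 * k + 1) M i k ≤ 1 :=
    fun i n => (hM.sum_coef_sq_le _ i n).trans (hM.diag_le i)
  funext i j
  have ht := tendsto_sum_toH2 (hle (2 * i)) (hle (2 * j))
  by_cases hij : i = j
  · subst hij
    have := le_of_tendsto' ht fun n => hM.sum_coef_sq_le _ (2 * i) n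
    simp only [genMat, gramPoint, if_true]
    rw [max_eq_left (sub_nonneg.2 this)]
    ring
  · simp only [genMat, gramPoint, hij, if_false, add_zero]
    refine tendsto_nhds_unique ht ?_
    simp only [sum_coef_mul_coef hM.nonneg hM.symm]
    simpa using (hlim i j hij).const_sub (M (2 * i) (2 * j))

lemma gramPoint_reindex (τ : ℕ → ℕ) (M : Mat) (i : ℕ) :
    gramPoint (fun i j => M (if i % 2 = 0 then 2 * τ (i / 2) else i)
      (if j % 2 = 0 then 2 * τ (j / 2) else j)) i = gramPoint M (τ i) := by
  have hc : coef (fun k => 2 * k + 1) (fun i j => M (if i % 2 = 0 then 2 * τ (i / 2) else i)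
      (if j % 2 = 0 then 2 * τ (j / 2) else j)) (2 * i)
      = coef (fun k => 2 * k + 1) M (2 * τ i) := by
    funext k
    have ho : ∀ k, (if (2 * k + 1) % 2 = 0 then 2 * τ ((2 * k + 1) / 2) else 2 * k + 1)
        = 2 * k + 1 := fun k => if_neg (by omega)
    have he : (if (2 * i) % 2 = 0 then 2 * τ ((2 * i) / 2) else 2 * i) = 2 * τ i := by simp
    simp only [coef, resid_reindex _ (fun i => if i % 2 = 0 then 2 * τ (i / 2) else i), ho, he]
  simp only [gramPoint, hc]
  simp

lemma isExchangeable_gramPoint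
    (hμ : ∀ σ : ℕ → ℕ, Function.Injective σ → μ.map (fun M i j => M (σ i) (σ j)) = μ) :
    IsExchangeable (μ.map gramPoint) := by
  intro τ hτ
  have hσ : Function.Injective fun i => if i % 2 = 0 then 2 * τ (i / 2) else i := by
    intro a b h
    dsimp only at h
    split_ifs at h
    · have := hτ (show τ (a / 2) = τ (b / 2) by omega)
      omega
    · omega
    · omega
    · exact h
  rw [Measure.map_map (by fun_prop) measurable_gramPoint]
  conv_rhs => rw [← hμ _ hσ]
  rw [Measure.map_map measurable_gramPoint (by fun_prop)]
  congr 1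
  funext M i
  exact (gramPoint_reindex τ M i).symm

end Gram

section Exchangeability

open MeasureTheory

/-- Restriction of an infinite matrix to its leading block. -/
def block (n : ℕ) (M : Mat) : Fin n → Fin n → ℝ := fun i j => M i j

lemma measurable_block (n : ℕ) : Measurable (block n) := by
  unfold block; fun_prop

lemma ext_of_map_block {μ ν : Measure Mat} [IsProbabilityMeasure μ] [IsProbabilityMeasure ν]
    (h : ∀ n, μ.map (block n) = ν.map (block n)) : μ = ν := by
  let m : ℕ → MeasurableSpace Mat := fun n => MeasurableSpace.comap (block n) inferInstance
  have hmono : Monotone m := by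
    intro a b hab
    have : block a = (fun (B : Fin b → Fin b → ℝ) (i j : Fin a) =>
      B (Fin.castLE hab i) (Fin.castLE hab j)) ∘ block b := rfl
    simp only [m]
    rw [this, ← MeasurableSpace.comap_comp]
    refine MeasurableSpace.comap_mono (Measurable.comap_le ?_)
    fun_prop
  have hgen : (inferInstance : MeasurableSpace Mat)
      = MeasurableSpace.generateFrom (⋃ n, {t | MeasurableSet[m n] t}) := by
    refine Eq.trans ?_ (MeasurableSpace.generateFrom_iUnion_measurableSet m).symm
    refine le_antisymm ?_ (iSup_le fun n => (measurable_block n).comap_le)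
    have hid : @Measurable Mat Mat (⨆ n, m n) inferInstance id := by
      refine @measurable_pi_lambda _ _ _ (⨆ n, m n) _ _ fun i =>
        @measurable_pi_lambda _ _ _ (⨆ n, m n) _ _ fun j => ?_
      have h1 : Measurable[m (max i j + 1)] fun M : Mat => M i j :=
        (Measurable.comp (g := fun B : Fin (max i j + 1) → Fin (max i j + 1) → ℝ =>
          B ⟨i, by omega⟩ ⟨j, by omega⟩) (by fun_prop) (comap_measurable (block (max i j + 1))))
      exact h1.mono (le_iSup m _) le_rfl
    intro s hs
    exact hid hs
  refine ext_of_generate_finite _ hgen (isPiSystem_iUnion_of_monotone _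
    (fun n => @MeasurableSpace.isPiSystem_measurableSet _ (m n))
    (fun a b hab s hs => hmono hab s hs)) (fun s hs => ?_) (by simp)
  obtain ⟨n, B, hB, rfl⟩ := Set.mem_iUnion.1 hs
  rw [← Measure.map_apply (measurable_block n) hB, h n, Measure.map_apply (measurable_block n) hB]

lemma map_reindex_eq {Ω : Type*} [MeasurableSpace Ω] {P : Measure Ω} [IsProbabilityMeasure P]
    {R : Ω → Mat} (hR : Measurable R)
    (h : ∀ (n : ℕ) (ρ : Equiv.Perm (Fin n)),
      P.map (fun ω => fun i j : Fin n => R ω (ρ i) (ρ j))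
        = P.map (fun ω => fun i j : Fin n => R ω i j))
    (σ : ℕ → ℕ) (hσ : Function.Injective σ) :
    (P.map R).map (fun M i j => M (σ i) (σ j)) = P.map R := by
  have hm : Measurable fun (M : Mat) (i j : ℕ) => M (σ i) (σ j) := by fun_prop
  have := Measure.isProbabilityMeasure_map (μ := P) hR.aemeasurable
  have := Measure.isProbabilityMeasure_map (μ := P.map R) hm.aemeasurable
  refine ext_of_map_block fun n => ?_
  obtain ⟨N, hN⟩ : ∃ N, ∀ i < n, σ i < N :=
    ⟨(Finset.range n).sup σ + 1, fun i hi =>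
      Nat.lt_succ_of_le (Finset.le_sup (f := σ) (Finset.mem_range.2 hi))⟩
  let K := max n N
  obtain ⟨ρ, hρ⟩ := Equiv.Perm.exists_extending_pair
    (fun i : Fin n => (⟨i, i.2.trans_le (le_max_left n N)⟩ : Fin K))
    (fun i : Fin n => (⟨σ i, (hN i i.2).trans_le (le_max_right n N)⟩ : Fin K))
    (fun a b hab => Fin.ext (by simpa using hab))
    (fun a b hab => Fin.ext (hσ (by simpa using hab)))
  let r : (Fin K → Fin K → ℝ) → (Fin n → Fin n → ℝ) := fun B i j =>
    B ⟨i, i.2.trans_le (le_max_left n N)⟩ ⟨j, j.2.trans_le (le_max_left n N)⟩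
  have hr : Measurable r := by fun_prop
  have e := congrArg (Measure.map r) (h K ρ)
  rw [Measure.map_map hr (by fun_prop), Measure.map_map hr (by fun_prop)] at e
  rw [Measure.map_map (measurable_block n) hm,
    Measure.map_map ((measurable_block n).comp hm) hR,
    Measure.map_map (measurable_block n) hR]
  convert e using 2
  · funext ω i j
    simp [r, block, hρ]
  · rfl

end Exchangeability

open MeasureTheory in
/-- **Dovbysh–Sudakov representation theorem**: the law of any Gram–de Finetti
matrix is a mixture of laws generated by i.i.d. samples from a random measure on
`H × [0,∞)` for a separable Hilbert space `H`. -/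
theorem dovbysh_sudakov {Ω₁ : Type*} [MeasurableSpace Ω₁]
    (P : Measure Ω₁) [IsProbabilityMeasure P] (R : Ω₁ → Mat)
    (hGdF : IsGramDeFinetti P R) :
    Nonempty (DovbyshSudakovRep P R) := by
  obtain ⟨hR, hbd, hsymm, hpsd, hex⟩ := hGdF
  have hinv := map_reindex_eq hR hex
  have hG : ∀ᵐ M ∂P.map R, IsGram M := by
    rw [ae_map_iff hR.aemeasurable measurableSet_isGram]
    filter_upwards [hbd, hsymm, hpsd] with ω h1 h2 h3
    refine ⟨h2, fun n c => ?_, fun i => (h1 i i).2⟩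
    have := h3 n fun i => c i
    simpa only [Finset.sum_range] using this
  have hP := Measure.isProbabilityMeasure_map (μ := P) hR.aemeasurable
  have hQ := Measure.isProbabilityMeasure_map (μ := P.map R) measurable_gramPoint.aemeasurable
  obtain ⟨Q, hQdef⟩ : ∃ Q, Q = (P.map R).map gramPoint := ⟨_, rfl⟩
  rw [← hQdef] at hQ
  have hQapp : ∀ S, MeasurableSet S → Q S = P.map R (gramPoint ⁻¹' S) := fun S hS => by
    rw [hQdef, Measure.map_apply measurable_gramPoint hS]
  have hexQ : IsExchangeable Q := hQdef ▸ isExchangeable_gramPoint hinv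
  let pos : H2 × ℝ → H2 × ℝ := fun p => (p.1, max p.2 0)
  have hpos : Measurable pos := by fun_prop
  let η : ProbabilityTheory.Kernel (ℕ → H2 × ℝ) (H2 × ℝ) := (directing Q).map pos
  have hη : ProbabilityTheory.IsMarkovKernel η :=
    ProbabilityTheory.Kernel.IsMarkovKernel.map _ hpos
  have hmix : Q = Q.bind (iidKernel η) := by
    refine eq_bind_iidKernel η fun n A hA => ?_
    have hA' : ∀ i, MeasurableSet (pos ⁻¹' A i) := fun i => hpos (hA i)
    have hpi : ∀ B : ℕ → Set (H2 × ℝ), (∀ i, MeasurableSet (B i)) →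
        MeasurableSet ((Finset.range n : Set ℕ).pi B) := fun B hB =>
      MeasurableSet.pi (Finset.countable_toSet _) fun i _ => hB i
    have h1 := hexQ.measure_cylinder hA' n
    have h2 : {y : ℕ → H2 × ℝ | ∀ i < n, y i ∈ pos ⁻¹' A i}
        = (Finset.range n : Set ℕ).pi fun i => pos ⁻¹' A i := by
      ext y; simp [Set.mem_pi]
    rw [h2] at h1
    have h3 : gramPoint ⁻¹' (Finset.range n : Set ℕ).pi A
        = gramPoint ⁻¹' (Finset.range n : Set ℕ).pi fun i => pos ⁻¹' A i := by
      ext M; simp [Set.mem_pi, pos, gramPoint]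
    rw [hQapp _ (hpi _ hA), h3, ← hQapp _ (hpi _ hA'), h1]
    refine lintegral_congr fun y => Finset.prod_congr rfl fun i _ => ?_
    rw [ProbabilityTheory.Kernel.map_apply' _ hpos _ (hA i)]
  have heven : Function.Injective fun k : ℕ => 2 * k := fun a b h => by simpa using h
  have hlaw : P.map R = Q.map genMat := by
    conv_lhs => rw [← hinv _ heven]
    rw [hQdef, Measure.map_map measurable_genMat measurable_gramPoint]
    refine Measure.map_congr ?_
    filter_upwards [genMat_gramPoint hG hinv] with M hM using hM.symm
  refine ⟨{
    Ω := ℕ → H2 × ℝ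
    Pr := Q
    prob := hQ
    η := η
    markov := hη
    pos := fun ω => ?_
    ν := iidKernel η
    markov' := inferInstance
    iid := fun ω n A hA => ?_
    rep := fun A hA => ?_ }⟩
  · rw [ProbabilityTheory.Kernel.map_apply' _ hpos _
      (measurableSet_lt measurable_snd measurable_const)]
    convert measure_empty (μ := directing Q ω)
    ext p
    simp [pos]
  · let B : ℕ → Set (H2 × ℝ) := fun i => if h : i < n then A ⟨i, h⟩ else Set.univ
    have hB : ∀ i, MeasurableSet (B i) := fun i => by
      by_cases h : i < n
      · simpa [B, h] using hA ⟨i, h⟩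
      · simp [B, h]
    have h1 := iidKernel_pi η ω hB n
    rw [Finset.prod_range] at h1
    have h2 : {x : ℕ → H2 × ℝ | ∀ i : Fin n, x (i : ℕ) ∈ A i}
        = (Finset.range n : Set ℕ).pi B := by
      ext x
      simp only [Set.mem_pi, Finset.coe_range, Set.mem_Iio, Fin.forall_iff]
      exact forall₂_congr fun i hi => by simp [B, hi]
    rw [h2, h1]
    exact Finset.prod_congr rfl fun i _ => by simp [B]
  · rw [hlaw, Measure.map_apply measurable_genMat hA]
    refine (congrArg (fun μ : Measure (ℕ → H2 × ℝ) => μ (genMat ⁻¹' A)) hmix).trans ?_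
    rw [Measure.bind_apply (measurable_genMat hA) (ProbabilityTheory.Kernel.aemeasurable _)]
    exact lintegral_congr fun ω => (Measure.map_apply measurable_genMat hA).symm

end
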